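/- Let p be a prime and let B be a commutative ring of characteristic p. Let ^φB denote B regarded as a B-module via the Frobenius endomorphism φ(b) = b^p. If ^φB has finite flat dimension over B, i.e. there exists d such that Tor_n^B(^φB, M) = 0 for every B-module M and every n ≥ d, then the structure homomorphism 𝔽_p → B is discretely regular; in particular, for every prime ideal q of B, the localization B_q is formally smooth over 𝔽_p for the ideal qB_q with the discrete topology. -/

import Mathlib

open TensorProduct CategoryTheory CategoryTheory.Limits

universe u v

/-- A (flat) ring homomorphism `A → B` is *discretely regular* if it is flat and, for every
prime ideal `q` of `B`, the localization `B_q` is formally smooth over `A` for the ideal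
`q B_q` with the discrete topology: every `A`-algebra map `B_q → C/M` with `M` square-zero,
such that the preimage in `C` of the ideal generated by the image of `q B_q` kills `M`,
lifts to an `A`-algebra map `B_q → C`. -/
def DiscretelyRegular (A : Type u) (B : Type v) [CommRing A] [CommRing B] [Algebra A B] : Prop :=
  Module.Flat A B ∧
  ∀ (q : Ideal B) [q.IsPrime],
    letI : Algebra A (Localization.AtPrime q) :=
      ((algebraMap B (Localization.AtPrime q)).comp (algebraMap A B)).toAlgebra
    ∀ (C : Type (max u v)) [CommRing C] [Algebra A C] (M : Ideal C), M ^ 2 = ⊥ →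
      ∀ u : Localization.AtPrime q →ₐ[A] C ⧸ M,
        (Ideal.comap (Ideal.Quotient.mk M)
            (Ideal.map u (Ideal.map (algebraMap B (Localization.AtPrime q)) q))) * M = ⊥ →
        ∃ g : Localization.AtPrime q →ₐ[A] C, (Ideal.Quotient.mkₐ A M).comp g = u

/-- `Frob p B` is the ring `B`, regarded as a `B`-algebra (in particular a `B`-module)
via the Frobenius `b ↦ b ^ p`. -/
def Frob (p : ℕ) (B : Type u) : Type u := B

instance Frob.instCommRing (p : ℕ) (B : Type u) [CommRing B] : CommRing (Frob p B) :=
  ‹CommRing B›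

noncomputable instance Frob.instAlgebra (p : ℕ) (B : Type u) [CommRing B] [Fact p.Prime]
    [CharP B p] : Algebra B (Frob p B) :=
  RingHom.toAlgebra (frobenius B p)

section Descent

variable {B : Type*} [CommRing B]

/-- One step of the construction of a null-homotopy along a complex of projectives. -/
theorem exists_homotopy_step
    {Y K I₀ I₁ I₂ : Type*} [AddCommGroup Y] [Module B Y] [Module.Projective B Y]
    [AddCommGroup K] [Module B K] [AddCommGroup I₀] [Module B I₀]
    [AddCommGroup I₁] [Module B I₁] [AddCommGroup I₂] [Module B I₂]
    {d₀ : I₀ →ₗ[B] I₁} {d₁ : I₁ →ₗ[B] I₂} (hd : Function.Exact d₀ d₁)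
    {D : Y →ₗ[B] Y} (hD : D ∘ₗ D = 0) {δ : K →ₗ[B] K}
    {g g' : Y →ₗ[B] K} (hg : δ ∘ₗ g' = g ∘ₗ D)
    {t : Y →ₗ[B] I₁} {t' : Y →ₗ[B] I₀} (ht : d₀ ∘ₗ t' = t ∘ₗ D)
    {h : K →ₗ[B] I₁} {h' : K →ₗ[B] I₀} (hh : d₀ ∘ₗ h' = h ∘ₗ δ)
    {w : Y →ₗ[B] I₁} (hw : d₁ ∘ₗ (h ∘ₗ g - t - w ∘ₗ D) = 0) :
    ∃ w' : Y →ₗ[B] I₀, d₀ ∘ₗ (h' ∘ₗ g' - t' - w' ∘ₗ D) = 0 := by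
  let e : Y →ₗ[B] LinearMap.range d₀ :=
    (h ∘ₗ g - t - w ∘ₗ D).codRestrict _ fun y ↦ (hd _).1 (LinearMap.congr_fun hw y)
  obtain ⟨w', hw'⟩ := Module.projective_lifting_property d₀.rangeRestrict e
    d₀.surjective_rangeRestrict
  have hw'' (y : Y) : d₀ (w' y) = h (g y) - t y - w (D y) :=
    congrArg Subtype.val (LinearMap.congr_fun hw' y)
  refine ⟨w', LinearMap.ext fun y ↦ ?_⟩
  have h1 := LinearMap.congr_fun hg y
  have h2 := LinearMap.congr_fun ht y
  have h3 := LinearMap.congr_fun hh (g' y)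
  have h4 := LinearMap.congr_fun hD y
  simp only [LinearMap.comp_apply, LinearMap.zero_apply] at h1 h2 h3 h4
  simp [hw'', h1, h2, h3, h4]

/-- One step of lifting the identity of `κ` along a Yoneda extension
`0 → κ → Q' → L → κ → 0` into an injective resolution. -/
theorem exists_yoneda_step
    {Q L κ I₀ I₁ I₂ : Type*} [AddCommGroup Q] [Module B Q] [AddCommGroup L] [Module B L]
    [AddCommGroup κ] [Module B κ] [AddCommGroup I₀] [Module B I₀]
    [AddCommGroup I₁] [Module B I₁] [AddCommGroup I₂] [Module B I₂]
    (h₀ : Module.Baer B I₀) (h₁ : Module.Baer B I₁)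
    (d₀ : I₀ →ₗ[B] I₁) (d₁ : I₁ →ₗ[B] I₂) (hd : d₁ ∘ₗ d₀ = 0)
    (π : Q →ₗ[B] L) (ε : L →ₗ[B] κ) (hπε : Function.Exact π ε) (hε : Function.Surjective ε)
    (θ : LinearMap.ker π →ₗ[B] κ) (z : κ →ₗ[B] I₀) (hz : d₀ ∘ₗ z = 0) :
    ∃ (α : Q →ₗ[B] I₀) (β : L →ₗ[B] I₁) (z' : κ →ₗ[B] I₂),
      (∀ x, α x.1 = z (θ x)) ∧ d₀ ∘ₗ α = β ∘ₗ π ∧ d₁ ∘ₗ β = z' ∘ₗ ε := by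
  obtain ⟨α, hα⟩ := h₀.extension_property (LinearMap.ker π).subtype
    Subtype.val_injective (z ∘ₗ θ)
  have hα' (x : LinearMap.ker π) : α x.1 = z (θ x) := LinearMap.congr_fun hα x
  have hker : LinearMap.ker π ≤ LinearMap.ker (d₀ ∘ₗ α) := fun x hx ↦ by
    simpa [hα' ⟨x, hx⟩] using LinearMap.congr_fun hz (θ ⟨x, hx⟩)
  obtain ⟨β, hβ⟩ := h₁.extension_property ((LinearMap.ker π).liftQ π le_rfl)
    (LinearMap.ker_eq_bot.1 (Submodule.ker_liftQ_eq_bot' _ _ rfl))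
    ((LinearMap.ker π).liftQ (d₀ ∘ₗ α) hker)
  have hβ' (x : Q) : β (π x) = d₀ (α x) := by
    simpa using LinearMap.congr_fun hβ (Submodule.Quotient.mk x)
  have hker' : LinearMap.ker ε ≤ LinearMap.ker (d₁ ∘ₗ β) := fun x hx ↦ by
    obtain ⟨y, rfl⟩ := (hπε x).1 hx
    simpa [hβ'] using LinearMap.congr_fun hd (α y)
  refine ⟨α, β, (LinearMap.ker ε).liftQ (d₁ ∘ₗ β) hker' ∘ₗ
    (ε.quotKerEquivOfSurjective hε).symm.toLinearMap, hα', ?_, ?_⟩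
  · ext x; simp [hβ']
  · ext x
    have : (ε.quotKerEquivOfSurjective hε).symm (ε x) = Submodule.Quotient.mk x := by
      rw [LinearEquiv.symm_apply_eq]; rfl
    simp [this]

variable {I₀ I₁ : ℕ → Type*}
    [∀ m, AddCommGroup (I₀ m)] [∀ m, Module B (I₀ m)]
    [∀ m, AddCommGroup (I₁ m)] [∀ m, Module B (I₁ m)]

/-- The lift of the identity of `κ` along the infinite splice of a Yoneda extension
`0 → κ → Q' → L → κ → 0` into an injective resolution. -/
theorem exists_yoneda_lift {Q L κ : Type*}
    [AddCommGroup Q] [Module B Q] [AddCommGroup L] [Module B L] [AddCommGroup κ] [Module B κ]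
    (d₀ : ∀ m, I₀ m →ₗ[B] I₁ m) (d₁ : ∀ m, I₁ m →ₗ[B] I₀ (m + 1))
    (h₀ : ∀ m, Module.Baer B (I₀ m)) (h₁ : ∀ m, Module.Baer B (I₁ m))
    (hd₁ : ∀ m, d₁ m ∘ₗ d₀ m = 0) (hd₀ : ∀ m, d₀ (m + 1) ∘ₗ d₁ m = 0)
    (π : Q →ₗ[B] L) (ε : L →ₗ[B] κ) (hπε : Function.Exact π ε) (hε : Function.Surjective ε)
    (θ : LinearMap.ker π →ₗ[B] κ) (z₀ : κ →ₗ[B] I₀ 0) (hz₀ : d₀ 0 ∘ₗ z₀ = 0) :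
    ∃ (α : ∀ m, Q →ₗ[B] I₀ m) (β : ∀ m, L →ₗ[B] I₁ m) (z : ∀ m, κ →ₗ[B] I₀ m),
      z 0 = z₀ ∧ (∀ m, d₀ m ∘ₗ z m = 0) ∧ (∀ m x, α m x.1 = z m (θ x)) ∧
      (∀ m, d₀ m ∘ₗ α m = β m ∘ₗ π) ∧ (∀ m, d₁ m ∘ₗ β m = z (m + 1) ∘ₗ ε) := by
  choose α β z' hα hβ hz' using fun m (z : {z : κ →ₗ[B] I₀ m // d₀ m ∘ₗ z = 0}) ↦
    exists_yoneda_step (h₀ m) (h₁ m) (d₀ m) (d₁ m) (hd₁ m) π ε hπε hε θ z.1 z.2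
  have hz'' (m z) : d₀ (m + 1) ∘ₗ z' m z = 0 := by
    ext x
    obtain ⟨y, rfl⟩ := hε x
    have h1 := LinearMap.congr_fun (hz' m z) y
    have h2 := LinearMap.congr_fun (hd₀ m) (β m z y)
    simp only [LinearMap.comp_apply, LinearMap.zero_apply] at h1 h2 ⊢
    rw [← h1, h2]
  let zs (m : ℕ) : {z : κ →ₗ[B] I₀ m // d₀ m ∘ₗ z = 0} :=
    Nat.rec ⟨z₀, hz₀⟩ (fun m z ↦ ⟨z' m z, hz'' m z⟩) m
  exact ⟨fun m ↦ α m (zs m), fun m ↦ β m (zs m), fun m ↦ (zs m).1, rfl, fun m ↦ (zs m).2,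
    fun m ↦ hα m (zs m), fun m ↦ hβ m (zs m), fun m ↦ hz' m (zs m)⟩

/-- A Yoneda extension `0 → κ → Q' → L → κ → 0` whose powers are detected by a complex `Y` of
projectives cannot become nilpotent on a bounded complex `K` through which `Y → κ` factors. -/
theorem false_of_bounded_factorization {Q L κ Y K : Type*}
    [AddCommGroup Q] [Module B Q] [AddCommGroup L] [Module B L] [AddCommGroup κ] [Module B κ]
    [AddCommGroup Y] [Module B Y] [Module.Projective B Y] [AddCommGroup K] [Module B K]
    (d₀ : ∀ m, I₀ m →ₗ[B] I₁ m) (d₁ : ∀ m, I₁ m →ₗ[B] I₀ (m + 1))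
    (h₀ : ∀ m, Module.Baer B (I₀ m)) (h₁ : ∀ m, Module.Baer B (I₁ m))
    (hd₁ : ∀ m, Function.Exact (d₀ m) (d₁ m)) (hd₀ : ∀ m, Function.Exact (d₁ m) (d₀ (m + 1)))
    (π : Q →ₗ[B] L) (ε : L →ₗ[B] κ) (hπε : Function.Exact π ε) (hε : Function.Surjective ε)
    (θ : LinearMap.ker π →ₗ[B] κ) (z₀ : κ →ₗ[B] I₀ 0) (hz₀ : d₀ 0 ∘ₗ z₀ = 0)
    (q : Ideal B) (hq : ∀ b ∈ q, ∀ v, d₀ 0 v = 0 → b • v = 0)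
    (δ : K →ₗ[B] K) (hδ : δ ∘ₗ δ = 0) (m₀ : ℕ)
    (hl₀ : ∀ m, m₀ ≤ m → ∀ c : K →ₗ[B] I₁ m, d₁ m ∘ₗ c = 0 → ∃ h : K →ₗ[B] I₀ m, d₀ m ∘ₗ h = c)
    (hl₁ : ∀ m, m₀ ≤ m → ∀ c : K →ₗ[B] I₀ (m + 1), d₀ (m + 1) ∘ₗ c = 0 →
      ∃ h : K →ₗ[B] I₁ m, d₁ m ∘ₗ h = c)
    (D : Y →ₗ[B] Y) (hD : D ∘ₗ D = 0)
    (g : ℕ → Y →ₗ[B] K) (hg : ∀ j, δ ∘ₗ g (j + 1) = g j ∘ₗ D) (J : ℕ) (hJ : ∀ j, J ≤ j → g j = 0)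
    (c : K →ₗ[B] κ) (hc : c ∘ₗ δ = 0)
    (lin : ℕ → Y →ₗ[B] Q) (aug : ℕ → Y →ₗ[B] L) (hcg : c ∘ₗ g 0 = ε ∘ₗ aug 0)
    (hlin : ∀ a, π ∘ₗ lin a = aug a ∘ₗ D)
    (haug : ∀ a y, ∃ h : lin a (D y) ∈ LinearMap.ker π, θ ⟨_, h⟩ = ε (aug (a + 1) y))
    (hY : ∀ a, ∃ y : Y, D y ∈ q • (⊤ : Submodule B Y) ∧ z₀ (ε (aug (a + 1) y)) ≠ 0) : False := by
  obtain ⟨α, β, z, rfl, hz, hα, hβ, hβz⟩ := exists_yoneda_lift d₀ d₁ h₀ h₁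
    (fun m ↦ (hd₁ m).linearMap_comp_eq_zero) (fun m ↦ (hd₀ m).linearMap_comp_eq_zero)
    π ε hπε hε θ z₀ hz₀
  have hα' (a m) : (α m ∘ₗ lin a) ∘ₗ D = z m ∘ₗ ε ∘ₗ aug (a + 1) := by
    ext y
    obtain ⟨h, h'⟩ := haug a y
    simpa [h'] using hα m ⟨_, h⟩
  have hβ' (a m) : d₀ m ∘ₗ (α m ∘ₗ lin a) = (β m ∘ₗ aug a) ∘ₗ D := by
    rw [← LinearMap.comp_assoc, hβ, LinearMap.comp_assoc, hlin, LinearMap.comp_assoc]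
  have hβz' (a m) : d₁ m ∘ₗ (β m ∘ₗ aug (a + 1)) = (α (m + 1) ∘ₗ lin a) ∘ₗ D := by
    rw [← LinearMap.comp_assoc, hβz, LinearMap.comp_assoc, hα']
  -- the lifting step, valid either in high cohomological degree or once `g` vanishes
  have half (m a : ℕ) (hm : m₀ ≤ m ∨ J ≤ 2 * a) (h : K →ₗ[B] I₁ m) (w : Y →ₗ[B] I₁ m)
      (hh : d₁ m ∘ₗ h ∘ₗ δ = 0)
      (hw : d₁ m ∘ₗ (h ∘ₗ g (2 * a) - β m ∘ₗ aug a - w ∘ₗ D) = 0) :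
      ∃ (h : K →ₗ[B] I₀ m) (w : Y →ₗ[B] I₀ m),
        d₀ m ∘ₗ h ∘ₗ δ = 0 ∧ d₀ m ∘ₗ (h ∘ₗ g (2 * a + 1) - α m ∘ₗ lin a - w ∘ₗ D) = 0 := by
    wlog hm' : m₀ ≤ m generalizing h
    · have hJ' := hJ (2 * a) (hm.resolve_left hm')
      obtain ⟨w', hw'⟩ := exists_homotopy_step (hd₁ m) hD (hg (2 * a)) (hβ' a m)
        (h := 0) (h' := 0) (by simp) (w := w) (by simpa [hJ'] using hw)
      exact ⟨0, w', by simp, hw'⟩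
    obtain ⟨h', hh'⟩ := hl₀ m hm' (h ∘ₗ δ) hh
    obtain ⟨w', hw'⟩ := exists_homotopy_step (hd₁ m) hD (hg (2 * a)) (hβ' a m) hh' hw
    exact ⟨h', w', by rw [← LinearMap.comp_assoc, hh', LinearMap.comp_assoc, hδ]; simp, hw'⟩
  have half' (m a : ℕ) (hm : m₀ ≤ m ∨ J ≤ 2 * a + 1) (h : K →ₗ[B] I₀ (m + 1))
      (w : Y →ₗ[B] I₀ (m + 1)) (hh : d₀ (m + 1) ∘ₗ h ∘ₗ δ = 0)
      (hw : d₀ (m + 1) ∘ₗ (h ∘ₗ g (2 * a + 1) - α (m + 1) ∘ₗ lin a - w ∘ₗ D) = 0) :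
      ∃ (h : K →ₗ[B] I₁ m) (w : Y →ₗ[B] I₁ m),
        d₁ m ∘ₗ h ∘ₗ δ = 0 ∧
          d₁ m ∘ₗ (h ∘ₗ g (2 * (a + 1)) - β m ∘ₗ aug (a + 1) - w ∘ₗ D) = 0 := by
    wlog hm' : m₀ ≤ m generalizing h
    · have hJ' := hJ (2 * a + 1) (hm.resolve_left hm')
      obtain ⟨w', hw'⟩ := exists_homotopy_step (hd₀ m) hD (hg (2 * a + 1)) (hβz' a m)
        (h := 0) (h' := 0) (by simp) (w := w) (by simpa [hJ'] using hw)
      exact ⟨0, w', by simp, hw'⟩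
    obtain ⟨h', hh'⟩ := hl₁ m hm' (h ∘ₗ δ) hh
    obtain ⟨w', hw'⟩ := exists_homotopy_step (hd₀ m) hD (hg (2 * a + 1)) (hβz' a m) hh' hw
    exact ⟨h', w', by rw [← LinearMap.comp_assoc, hh', LinearMap.comp_assoc, hδ]; simp, hw'⟩
  have main (a : ℕ) : ∀ m, m + a = m₀ + J → ∃ (h : K →ₗ[B] I₁ m) (w : Y →ₗ[B] I₁ m),
      d₁ m ∘ₗ h ∘ₗ δ = 0 ∧ d₁ m ∘ₗ (h ∘ₗ g (2 * a) - β m ∘ₗ aug a - w ∘ₗ D) = 0 := by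
    induction a with
    | zero =>
      intro m hm
      obtain ⟨h, hh⟩ := hl₁ m (by omega) (z (m + 1) ∘ₗ c)
        (by rw [← LinearMap.comp_assoc, hz, LinearMap.zero_comp])
      refine ⟨h, 0, ?_, ?_⟩
      · rw [← LinearMap.comp_assoc, hh, LinearMap.comp_assoc, hc, LinearMap.comp_zero]
      · rw [LinearMap.zero_comp, sub_zero, LinearMap.comp_sub, ← LinearMap.comp_assoc, hh,
          ← LinearMap.comp_assoc, hβz, LinearMap.comp_assoc, LinearMap.comp_assoc, ← hcg, sub_self]
    | succ a ih =>
      intro m hm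
      obtain ⟨h, w, hh, hw⟩ := ih (m + 1) (by omega)
      obtain ⟨h, w, hh, hw⟩ := half (m + 1) a (by omega) h w hh hw
      exact half' m a (by omega) h w hh hw
  obtain ⟨h, w, hh, hw⟩ := main (m₀ + J) 0 (by omega)
  obtain ⟨h, w, -, hw⟩ := half 0 (m₀ + J) (by omega) h w hh hw
  rw [hJ _ (by omega), LinearMap.comp_zero, zero_sub] at hw
  obtain ⟨y, hy, hy'⟩ := hY (m₀ + J)
  have hvan (x : Y) (hx : x ∈ q • (⊤ : Submodule B Y)) :
      (-(α 0 ∘ₗ lin (m₀ + J)) - w ∘ₗ D) x = 0 := by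
    induction hx using Submodule.smul_induction_on' with
    | smul b hb x _ => rw [map_smul]; exact hq b hb _ (LinearMap.congr_fun hw x)
    | add x _ y _ hx hy => rw [map_add, hx, hy, add_zero]
  have h1 := hvan _ hy
  have h2 := LinearMap.congr_fun hD y
  have h3 := LinearMap.congr_fun (hα' (m₀ + J) 0) y
  simp only [LinearMap.comp_apply, LinearMap.zero_apply, LinearMap.sub_apply,
    LinearMap.neg_apply] at h1 h2 h3
  rw [h2, map_zero, sub_zero, neg_eq_zero, h3] at h1
  exact hy' h1

end Descent

section CharacterModule

variable {B : Type*} [CommRing B]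

theorem CharacterModule.dual_exact {M N P : Type*} [AddCommGroup M] [Module B M]
    [AddCommGroup N] [Module B N] [AddCommGroup P] [Module B P]
    {f : M →ₗ[B] N} {g : N →ₗ[B] P} (h : Function.Exact f g) :
    Function.Exact (CharacterModule.dual g) (CharacterModule.dual f) := by
  intro χ
  constructor
  · intro hχ
    have hχ' (x : M) : χ (f x) = 0 := DFunLike.congr_fun hχ x
    have hker : LinearMap.ker g.toAddMonoidHom.toIntLinearMap ≤
        LinearMap.ker (AddMonoidHom.toIntLinearMap χ) := fun x hx ↦ by
      obtain ⟨y, rfl⟩ := (h x).1 hx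
      exact hχ' y
    obtain ⟨c, hc⟩ := (Module.Baer.of_divisible (AddCircle (1 : ℚ))).extension_property
      ((LinearMap.ker g.toAddMonoidHom.toIntLinearMap).liftQ _ le_rfl)
      (LinearMap.ker_eq_bot.1 (Submodule.ker_liftQ_eq_bot' _ _ rfl))
      ((LinearMap.ker g.toAddMonoidHom.toIntLinearMap).liftQ
        (AddMonoidHom.toIntLinearMap χ) hker)
    exact ⟨c.toAddMonoidHom, DFunLike.ext _ _ fun x ↦
      LinearMap.congr_fun hc (Submodule.Quotient.mk x)⟩
  · rintro ⟨χ, rfl⟩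
    exact DFunLike.ext _ _ fun x ↦ (congrArg χ (h.apply_apply_eq_zero x)).trans (map_zero χ)

/-- A map into a character module killed by the dual of `f` lifts along the dual of `g`
when `S ⊗ f` and `S ⊗ g` are exact. -/
theorem CharacterModule.exists_dual_comp_eq {S M N P : Type*} [AddCommGroup S] [Module B S]
    [AddCommGroup M] [Module B M] [AddCommGroup N] [Module B N] [AddCommGroup P] [Module B P]
    {f : M →ₗ[B] N} {g : N →ₗ[B] P} (h : Function.Exact (f.lTensor S) (g.lTensor S))
    (c : S →ₗ[B] CharacterModule N) (hc : CharacterModule.dual f ∘ₗ c = 0) :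
    ∃ l : S →ₗ[B] CharacterModule P, CharacterModule.dual g ∘ₗ l = c := by
  have h0 : CharacterModule.dual (f.lTensor S) (CharacterModule.uncurry c) = 0 := by
    refine DFunLike.ext _ _ fun x ↦ ?_
    induction x with
    | zero => exact map_zero _
    | tmul s x => exact DFunLike.congr_fun (LinearMap.congr_fun hc s) x
    | add x y hx hy => rw [map_add, hx, hy, map_add]
  obtain ⟨χ, hχ⟩ := (CharacterModule.dual_exact h _).1 h0
  refine ⟨CharacterModule.curry χ, LinearMap.ext fun s ↦ DFunLike.ext _ _ fun x ↦ ?_⟩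
  exact DFunLike.congr_fun hχ (s ⊗ₜ x)

end CharacterModule

section Resolution

variable {B : Type u} [CommRing B]

theorem exists_projective_resolution_of_isZero_tor (S κ : Type u) [AddCommGroup S] [Module B S]
    [AddCommGroup κ] [Module B κ] (N : ℕ)
    (h : ∀ n, N ≤ n →
      IsZero (((Tor (ModuleCat.{u} B) n).obj (ModuleCat.of B S)).obj (ModuleCat.of B κ))) :
    ∃ (X : ℕ → Type u) (_ : ∀ n, AddCommGroup (X n)) (_ : ∀ n, Module B (X n))
      (d : ∀ n, X (n + 1) →ₗ[B] X n) (ε : X 0 →ₗ[B] κ),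
      (∀ n, Module.Projective B (X n)) ∧ (∀ n, Function.Exact (d (n + 1)) (d n)) ∧
      Function.Surjective ε ∧ Function.Exact (d 0) ε ∧
      ∀ n, N ≤ n + 1 → Function.Exact ((d (n + 1)).lTensor S) ((d n).lTensor S) := by
  let P := projectiveResolution (ModuleCat.of B κ)
  refine ⟨fun n ↦ P.complex.X n, inferInstance, inferInstance,
    fun n ↦ (P.complex.d (n + 1) n).hom, (P.π.f 0).hom, fun n ↦ ?_, fun n ↦ ?_, ?_, ?_,
    fun n hn ↦ ?_⟩
  · exact (IsProjective.iff_projective _).2 (P.projective n)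
  · exact (ShortComplex.ShortExact.moduleCat_exact_iff_function_exact _).1 (P.exact_succ n)
  · exact (ModuleCat.epi_iff_surjective _).1 inferInstance
  · exact (ShortComplex.ShortExact.moduleCat_exact_iff_function_exact _).1 P.exact₀
  · have h1 := (h (n + 1) hn).of_iso (P.isoLeftDerivedObj
      ((MonoidalCategory.tensoringLeft (ModuleCat.{u} B)).obj (ModuleCat.of B S)) (n + 1)).symm
    have h2 := (HomologicalComplex.exactAt_iff_isZero_homology _ _).2 h1
    have h3 := (HomologicalComplex.exactAt_iff' _ (n + 2) (n + 1) n (by simp) (by simp)).1 h2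
    exact (ShortComplex.ShortExact.moduleCat_exact_iff_function_exact _).1 h3

/-- If `Tor_n(S, κ)` vanishes for `n ≥ N`, the character module of `κ` has an injective
resolution along which maps out of `S` lift in degrees beyond `N`. -/
theorem exists_injective_resolution_of_isZero_tor (S κ : Type u) [AddCommGroup S] [Module B S]
    [AddCommGroup κ] [Module B κ] (N : ℕ)
    (h : ∀ n, N ≤ n →
      IsZero (((Tor (ModuleCat.{u} B) n).obj (ModuleCat.of B S)).obj (ModuleCat.of B κ))) :
    ∃ (I : ℕ → Type u) (_ : ∀ n, AddCommGroup (I n)) (_ : ∀ n, Module B (I n))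
      (d : ∀ n, I n →ₗ[B] I (n + 1)) (ι : CharacterModule κ →ₗ[B] I 0),
      (∀ n, Module.Baer B (I n)) ∧ (∀ n, Function.Exact (d n) (d (n + 1))) ∧
      Function.Injective ι ∧ Function.Exact ι (d 0) ∧
      ∀ n, N ≤ n + 1 → ∀ c : S →ₗ[B] I (n + 1), d (n + 1) ∘ₗ c = 0 →
        ∃ l : S →ₗ[B] I n, d n ∘ₗ l = c := by
  obtain ⟨X, _, _, d, ε, hX, hd, hε, hdε, hS⟩ := exists_projective_resolution_of_isZero_tor S κ N h
  exact ⟨fun n ↦ CharacterModule (X n), inferInstance, inferInstance,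
    fun n ↦ CharacterModule.dual (d n), CharacterModule.dual ε,
    fun n ↦ Module.Flat.iff_characterModule_baer.1 inferInstance,
    fun n ↦ CharacterModule.dual_exact (hd n), CharacterModule.dual_injective_of_surjective _ hε,
    CharacterModule.dual_exact hdε,
    fun n hn c hc ↦ CharacterModule.exists_dual_comp_eq (hS n hn) c hc⟩

end Resolution

section Exterior

theorem exists_mul_eq_pow_sub_add_pow (p : ℕ) [Fact p.Prime] {S : Type*} [CommRing S] [CharP S p]
    (f β : S) : ∃ c, c * f = β ^ (p - 1) - (f + β) ^ (p - 1) ∧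
      c * β = (f + β) ^ (p - 1) - f ^ (p - 1) := by
  let P := MvPolynomial Bool (ZMod p)
  let X : P := MvPolynomial.X true
  let Y : P := MvPolynomial.X false
  have hp : p - 1 + 1 = p := Nat.sub_add_cancel (Fact.out : p.Prime).one_le
  have hX : X ≠ 0 := MvPolynomial.X_ne_zero _
  obtain ⟨c, hc⟩ : X ∣ Y ^ (p - 1) - (X + Y) ^ (p - 1) := by
    have h := sub_dvd_pow_sub_pow Y (X + Y) (p - 1)
    rwa [sub_add_cancel_right, neg_dvd] at h
  have hc' : c * Y = (X + Y) ^ (p - 1) - X ^ (p - 1) := by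
    apply mul_left_cancel₀ hX
    have h1 : X ^ p = X ^ (p - 1) * X := by rw [← pow_succ, hp]
    have h2 : Y ^ p = Y ^ (p - 1) * Y := by rw [← pow_succ, hp]
    have h3 : (X + Y) ^ p = (X + Y) ^ (p - 1) * (X + Y) := by rw [← pow_succ, hp]
    have h4 := add_pow_char (R := P) (p := p) X Y
    linear_combination (-Y) * hc - h2 + h3 - h4 - h1
  let _ := ZMod.algebra S p
  let F : P →ₐ[ZMod p] S := MvPolynomial.aeval fun i ↦ if i then f else β
  have hFX : F X = f := MvPolynomial.aeval_X _ _
  have hFY : F Y = β := MvPolynomial.aeval_X _ _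
  refine ⟨F c, ?_, ?_⟩
  · simpa [hFX, hFY, mul_comm] using (congrArg F hc).symm
  · simpa [hFX, hFY] using congrArg F hc'

open ExteriorAlgebra CliffordAlgebra in
/-- The contraction of the exterior algebra by a linear form. -/
noncomputable abbrev koszulDiff {R V : Type*} [CommRing R] [AddCommGroup V] [Module R V]
    (ξ : Module.Dual R V) : ExteriorAlgebra R V →ₗ[R] ExteriorAlgebra R V :=
  contractLeft ξ

section Koszul

variable {R V : Type*} [CommRing R] [AddCommGroup V] [Module R V] (ξ : Module.Dual R V)

theorem koszulDiff_ι_mul (v : V) (μ : ExteriorAlgebra R V) :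
    koszulDiff ξ (ExteriorAlgebra.ι R v * μ) =
      ξ v • μ - ExteriorAlgebra.ι R v * koszulDiff ξ μ :=
  CliffordAlgebra.contractLeft_ι_mul _ _ _

theorem koszulDiff_algebraMap (r : R) :
    koszulDiff ξ (algebraMap R (ExteriorAlgebra R V) r) = 0 :=
  CliffordAlgebra.contractLeft_algebraMap _ _ _

theorem koszulDiff_one : koszulDiff ξ (1 : ExteriorAlgebra R V) = 0 :=
  CliffordAlgebra.contractLeft_one _ _

theorem koszulDiff_koszulDiff (μ : ExteriorAlgebra R V) :
    koszulDiff ξ (koszulDiff ξ μ) = 0 :=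
  CliffordAlgebra.contractLeft_contractLeft _ _

theorem ι_mul_ι_mul_swap (v w : V) (μ : ExteriorAlgebra R V) :
    ExteriorAlgebra.ι R v * (ExteriorAlgebra.ι R w * μ) =
      -(ExteriorAlgebra.ι R w * (ExteriorAlgebra.ι R v * μ)) := by
  rw [← mul_assoc, ← mul_assoc, ← neg_mul, ← eq_neg_of_add_eq_zero_left]
  exact ExteriorAlgebra.ι_add_mul_swap v w

theorem ι_mul_ι_mul_self (v : V) (μ : ExteriorAlgebra R V) :
    ExteriorAlgebra.ι R v * (ExteriorAlgebra.ι R v * μ) = 0 := by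
  rw [← mul_assoc, ExteriorAlgebra.ι_sq_zero, zero_mul]

/-- A finite sequence of divided powers of a primitive of the vector `z` in a Koszul complex. -/
def HasDividedPowers (z : V) : Prop :=
  ∃ W : ℕ → ExteriorAlgebra R V, W 0 = 1 ∧
    (∀ a, koszulDiff ξ (W (a + 1)) = ExteriorAlgebra.ι R z * W a) ∧ ∃ N, ∀ a, N ≤ a → W a = 0

variable {ξ}

theorem HasDividedPowers.zero : HasDividedPowers ξ (0 : V) :=
  ⟨fun a ↦ if a = 0 then 1 else 0, by simp, by simp, 1, fun a ha ↦ by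
    simp [Nat.one_le_iff_ne_zero.1 ha]⟩

theorem HasDividedPowers.add {z : V} (h : HasDividedPowers ξ z) (u v : V) :
    HasDividedPowers ξ (z + (ξ u • v - ξ v • u)) := by
  obtain ⟨W, hW0, hW, N, hN⟩ := h
  let W' : ℕ → ExteriorAlgebra R V
    | 0 => 1
    | a + 1 => W (a + 1) + ExteriorAlgebra.ι R u * (ExteriorAlgebra.ι R v * W a)
  have hδ (X : ExteriorAlgebra R V) :
      koszulDiff ξ (ExteriorAlgebra.ι R u * (ExteriorAlgebra.ι R v * X)) =
        ExteriorAlgebra.ι R (ξ u • v - ξ v • u) * X +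
          ExteriorAlgebra.ι R u * (ExteriorAlgebra.ι R v * koszulDiff ξ X) := by
    simp only [koszulDiff_ι_mul, map_sub, map_smul, sub_mul, mul_sub, smul_mul_assoc,
      mul_smul_comm]
    abel
  refine ⟨W', rfl, fun a ↦ ?_, N + 1, fun a ha ↦ ?_⟩
  · cases a with
    | zero =>
      simp only [W']
      rw [map_add, hδ, hW, hW0, koszulDiff_one, map_add, mul_zero, mul_zero, add_zero]
      simp only [mul_one]
    | succ a =>
      have h0 : ExteriorAlgebra.ι R (ξ u • v - ξ v • u) *
          (ExteriorAlgebra.ι R u * (ExteriorAlgebra.ι R v * W a)) = 0 := by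
        rw [map_sub, map_smul, map_smul, sub_mul, smul_mul_assoc, smul_mul_assoc,
          ι_mul_ι_mul_self, ι_mul_ι_mul_swap v, ι_mul_ι_mul_self, mul_zero, neg_zero]
        simp
      simp only [W']
      rw [map_add, hδ, hW, hW, map_add (ExteriorAlgebra.ι R), add_mul, mul_add, mul_add, h0,
        ι_mul_ι_mul_swap v z, mul_neg, ι_mul_ι_mul_swap u z, neg_neg, add_zero]
      abel
  · obtain ⟨a, rfl⟩ : ∃ b, a = b + 1 := ⟨a - 1, by omega⟩
    simp [W', hN a (by omega), hN (a + 1) (by omega)]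

end Koszul

theorem hasDividedPowers_of_sum_eq_zero (p : ℕ) [Fact p.Prime] {S : Type*} [CommRing S] [CharP S p]
    {V ι : Type*} [AddCommGroup V] [Module S V] [Fintype ι] (ξ : Module.Dual S V) (η : ι → V)
    (h : ∑ i, ξ (η i) = 0) :
    HasDividedPowers ξ (∑ i, ξ (η i) ^ (p - 1) • η i) := by
  classical
  have key (s : Finset ι) : HasDividedPowers ξ (∑ i ∈ s, ξ (η i) ^ (p - 1) • η i -
      (∑ i ∈ s, ξ (η i)) ^ (p - 1) • ∑ i ∈ s, η i) := by
    induction s using Finset.induction_on with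
    | empty => simpa using HasDividedPowers.zero
    | insert j s hj ih =>
      obtain ⟨c, hc, hc'⟩ := exists_mul_eq_pow_sub_add_pow p (∑ i ∈ s, ξ (η i)) (ξ (η j))
      convert ih.add (c • ∑ i ∈ s, η i) (η j) using 1
      rw [map_smul, map_sum, smul_eq_mul, hc, smul_smul, mul_comm _ c, hc',
        Finset.sum_insert hj, Finset.sum_insert hj, Finset.sum_insert hj, add_comm (ξ (η j))]
      module
  have := key Finset.univ
  rwa [h, zero_pow (Nat.sub_ne_zero_of_lt (Fact.out : p.Prime).one_lt), zero_smul,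
    sub_zero] at this

end Exterior

section Grading

variable {R V : Type*} [CommRing R] [AddCommGroup V] [Module R V]

/-- The projection of the exterior algebra to its homogeneous part of degree `n`, extended by
zero to negative degrees. -/
noncomputable def extProj (R : Type*) {V : Type*} [CommRing R] [AddCommGroup V] [Module R V]
    (n : ℤ) : ExteriorAlgebra R V →ₗ[R] ExteriorAlgebra R V :=
  if 0 ≤ n then GradedAlgebra.proj (fun i : ℕ ↦ ⋀[R]^i V) n.toNat else 0

theorem extProj_ι_mul (n : ℤ) (v : V) (μ : ExteriorAlgebra R V) :
    extProj R (n + 1) (ExteriorAlgebra.ι R v * μ) = ExteriorAlgebra.ι R v * extProj R n μ := by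
  have hv : ExteriorAlgebra.ι R v ∈ ⋀[R]^1 V := by simp
  rcases lt_trichotomy n (-1) with h | rfl | h
  · rw [extProj, extProj, if_neg (by omega), if_neg (by omega)]; simp
  · rw [extProj, extProj, if_pos (by omega), if_neg (by omega)]
    simpa [GradedAlgebra.proj_apply] using
      DirectSum.coe_decompose_mul_of_left_mem_of_not_le (fun i : ℕ ↦ ⋀[R]^i V) (b := μ) hv
        (n := 0) (by simp)
  · obtain ⟨n, rfl⟩ : ∃ k : ℕ, n = k := ⟨n.toNat, by omega⟩
    rw [extProj, extProj, if_pos (by omega), if_pos (by omega), GradedAlgebra.proj_apply,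
      GradedAlgebra.proj_apply, Int.toNat_natCast, show ((n : ℤ) + 1).toNat = 1 + n by omega]
    exact DirectSum.coe_decompose_mul_add_of_left_mem (fun i : ℕ ↦ ⋀[R]^i V) hv

theorem extProj_algebraMap (n : ℤ) (r : R) :
    extProj R n (algebraMap R (ExteriorAlgebra R V) r) =
      if n = 0 then algebraMap R (ExteriorAlgebra R V) r else 0 := by
  have hr : algebraMap R (ExteriorAlgebra R V) r ∈ ⋀[R]^0 V := by simp
  split_ifs with h
  · subst h
    rw [extProj, if_pos le_rfl, GradedAlgebra.proj_apply, Int.toNat_zero]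
    exact DirectSum.decompose_of_mem_same (fun i : ℕ ↦ ⋀[R]^i V) hr
  · rw [extProj]
    split_ifs with h'
    · rw [GradedAlgebra.proj_apply]
      exact DirectSum.decompose_of_mem_ne (fun i : ℕ ↦ ⋀[R]^i V) hr (by omega)
    · rfl

@[elab_as_elim]
theorem exteriorAlgebra_induction {P : ExteriorAlgebra R V → Prop}
    (algebraMap : ∀ r, P (algebraMap R _ r)) (add : ∀ x y, P x → P y → P (x + y))
    (ι_mul : ∀ v x, P x → P (ExteriorAlgebra.ι R v * x)) (x : ExteriorAlgebra R V) : P x :=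
  CliffordAlgebra.left_induction _ algebraMap add (fun x v hx ↦ ι_mul v x hx) x

theorem koszulDiff_extProj (ξ : Module.Dual R V) (n : ℤ) (μ : ExteriorAlgebra R V) :
    koszulDiff ξ (extProj R (n + 1) μ) = extProj R n (koszulDiff ξ μ) := by
  induction μ using exteriorAlgebra_induction generalizing n with
  | algebraMap r =>
    rw [extProj_algebraMap, koszulDiff_algebraMap, map_zero]
    split_ifs
    · exact koszulDiff_algebraMap _ _
    · exact map_zero _
  | add x y hx hy => rw [map_add, map_add, map_add, map_add, hx, hy]
  | ι_mul v x hx =>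
    rw [extProj_ι_mul, koszulDiff_ι_mul, koszulDiff_ι_mul, map_sub, map_smul,
      ← sub_add_cancel n 1, extProj_ι_mul, hx]

theorem extProj_zero_eq (μ : ExteriorAlgebra R V) :
    extProj R 0 μ = algebraMap R _ (ExteriorAlgebra.algebraMapInv μ) := by
  induction μ using exteriorAlgebra_induction with
  | algebraMap r => rw [extProj_algebraMap, if_pos rfl, ExteriorAlgebra.algebraMap_leftInverse]
  | add x y hx hy => rw [map_add, map_add, map_add, hx, hy]
  | ι_mul v x hx =>
    have h := extProj_ι_mul (-1) v x
    rw [neg_add_cancel] at h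
    rw [h, extProj, if_neg (by omega), map_mul]
    simp [ExteriorAlgebra.algebraMapInv]

theorem exists_forall_extProj_eq_zero [Module.Finite R (ExteriorAlgebra R V)] :
    ∃ N : ℤ, ∀ n, N ≤ n → (extProj R n : ExteriorAlgebra R V →ₗ[R] _) = 0 := by
  classical
  obtain ⟨s, hs⟩ := (Module.Finite.fg_top : (⊤ : Submodule R (ExteriorAlgebra R V)).FG)
  have (x : ExteriorAlgebra R V) : ∃ N : ℕ, ∀ n : ℤ, (N : ℤ) ≤ n → extProj R n x = 0 := by
    refine ⟨((DirectSum.decompose (fun i : ℕ ↦ ⋀[R]^i V) x).support).sup id + 1, fun n hn ↦ ?_⟩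
    rw [extProj, if_pos (by omega), GradedAlgebra.proj_apply]
    by_contra h
    have h' : n.toNat ∈ (DirectSum.decompose (fun i : ℕ ↦ ⋀[R]^i V) x).support := by
      rw [DFinsupp.mem_support_iff]
      exact fun h0 ↦ h (by rw [h0]; rfl)
    have := Finset.le_sup (f := id) h'
    simp only [id] at this
    omega
  choose N hN using this
  refine ⟨(s.sup N : ℕ), fun n hn ↦ LinearMap.ext_on hs fun x hx ↦ ?_⟩
  exact hN x n (le_trans (by exact_mod_cast Finset.le_sup hx) hn)

end Grading

section KoszulFrobenius

theorem ExteriorAlgebra.free_finite (R : Type*) [CommRing R] (r : ℕ) :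
    Module.Free R (ExteriorAlgebra R (Fin r → R)) ∧
      Module.Finite R (ExteriorAlgebra R (Fin r → R)) :=
  ⟨.of_basis (Pi.basisFun R (Fin r)).ExteriorAlgebra,
    .of_basis (Pi.basisFun R (Fin r)).ExteriorAlgebra⟩

/-- The linear form with coefficients `x`. -/
def coeffForm {R : Type*} [CommRing R] {r : ℕ} (x : Fin r → R) : Module.Dual R (Fin r → R) :=
  ∑ i, x i • LinearMap.proj i

theorem coeffForm_apply {R : Type*} [CommRing R] {r : ℕ} (x v : Fin r → R) :
    coeffForm x v = ∑ i, x i * v i := by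
  simp [coeffForm]

/-- The total differential of the bicomplex obtained from the Koszul complex of `ξ` by
periodic repetition, with multiplication by the vector `a` as second differential. -/
noncomputable def periodicDiff {R V : Type*} [CommRing R] [AddCommGroup V] [Module R V]
    (ξ : Module.Dual R V) (a : V) :
    (ℕ →₀ ExteriorAlgebra R V) →ₗ[R] ℕ →₀ ExteriorAlgebra R V :=
  Finsupp.mapRange.linearMap (koszulDiff ξ) +
    Finsupp.mapRange.linearMap (LinearMap.mulLeft R (ExteriorAlgebra.ι R a)) ∘ₗ
      Finsupp.lcomapDomain Nat.succ Nat.succ_injective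

section

variable {R V : Type*} [CommRing R] [AddCommGroup V] [Module R V] (ξ : Module.Dual R V) (a : V)

theorem periodicDiff_apply (y : ℕ →₀ ExteriorAlgebra R V) (n : ℕ) :
    periodicDiff ξ a y n = koszulDiff ξ (y n) + ExteriorAlgebra.ι R a * y (n + 1) := rfl

theorem periodicDiff_single_zero (μ : ExteriorAlgebra R V) :
    periodicDiff ξ a (.single 0 μ) = .single 0 (koszulDiff ξ μ) := by
  ext n
  rw [periodicDiff_apply]
  cases n <;> simp

theorem periodicDiff_single_succ (n : ℕ) (μ : ExteriorAlgebra R V) :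
    periodicDiff ξ a (.single (n + 1) μ) =
      .single (n + 1) (koszulDiff ξ μ) + .single n (ExteriorAlgebra.ι R a * μ) := by
  ext m
  rw [periodicDiff_apply]
  simp only [Finsupp.single_apply, Finsupp.add_apply, Nat.add_right_cancel_iff]
  split_ifs <;> simp

theorem periodicDiff_periodicDiff (h : ξ a = 0) (y : ℕ →₀ ExteriorAlgebra R V) :
    periodicDiff ξ a (periodicDiff ξ a y) = 0 := by
  ext n
  simp [periodicDiff_apply, koszulDiff_koszulDiff, koszulDiff_ι_mul, h, mul_add,
    ι_mul_ι_mul_self]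

end

variable {B S : Type*} [CommRing B] [CommRing S] [Algebra B S] {r : ℕ}

/-- The map of exterior algebras over `B → S` given by the diagonal matrix `t`. -/
noncomputable def extDiag (t : Fin r → S) :
    ExteriorAlgebra B (Fin r → B) →ₐ[B] ExteriorAlgebra S (Fin r → S) :=
  ExteriorAlgebra.lift B ⟨(ExteriorAlgebra.ι S).restrictScalars B ∘ₗ
    LinearMap.pi fun i ↦ LinearMap.toSpanSingleton B S (t i) ∘ₗ LinearMap.proj i,
    fun _ ↦ ExteriorAlgebra.ι_sq_zero _⟩

theorem extDiag_ι (t : Fin r → S) (v : Fin r → B) :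
    extDiag t (ExteriorAlgebra.ι B v) = ExteriorAlgebra.ι S fun i ↦ v i • t i :=
  ExteriorAlgebra.lift_ι_apply _ _ _ _

theorem koszulDiff_extDiag {t y : Fin r → S} {x : Fin r → B}
    (h : ∀ i, algebraMap B S (x i) = y i * t i) (μ : ExteriorAlgebra B (Fin r → B)) :
    koszulDiff (coeffForm y) (extDiag t μ) = extDiag t (koszulDiff (coeffForm x) μ) := by
  induction μ using exteriorAlgebra_induction with
  | algebraMap c =>
    rw [koszulDiff_algebraMap, AlgHom.commutes, map_zero,
      IsScalarTower.algebraMap_apply B S, koszulDiff_algebraMap]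
  | add μ ν hμ hν => simp only [map_add, hμ, hν]
  | ι_mul v μ hμ =>
    rw [map_mul, extDiag_ι, koszulDiff_ι_mul, koszulDiff_ι_mul, map_sub, map_smul, map_mul, hμ,
      extDiag_ι, ← algebraMap_smul S (coeffForm x v)]
    congr 2
    simp only [coeffForm_apply, map_sum, map_mul, h, Algebra.smul_def]
    exact Finset.sum_congr rfl fun i _ ↦ by ring

theorem koszulDiff_extDiag_mul {t y : Fin r → S} {x : Fin r → B}
    (h : ∀ i, algebraMap B S (x i) = y i * t i) {z : Fin r → S}
    {W W' : ExteriorAlgebra S (Fin r → S)}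
    (hW : koszulDiff (coeffForm y) W' = ExteriorAlgebra.ι S z * W)
    (μ : ExteriorAlgebra B (Fin r → B)) :
    koszulDiff (coeffForm y) (extDiag t μ * W') =
      extDiag t (koszulDiff (coeffForm x) μ) * W' + ExteriorAlgebra.ι S z * (extDiag t μ * W) := by
  induction μ using exteriorAlgebra_induction with
  | algebraMap c =>
    rw [koszulDiff_algebraMap, AlgHom.commutes, map_zero, IsScalarTower.algebraMap_apply B S,
      ← Algebra.smul_def, map_smul, hW, zero_mul, zero_add, ← Algebra.smul_def, mul_smul_comm]
  | add μ ν hμ hν => simp only [map_add, hμ, hν, add_mul, mul_add]; abel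
  | ι_mul v μ hμ =>
    rw [← koszulDiff_extDiag h, map_mul (extDiag t), mul_assoc, extDiag_ι, koszulDiff_ι_mul, hμ,
      koszulDiff_ι_mul, sub_mul, mul_assoc, mul_assoc, ι_mul_ι_mul_swap z, smul_mul_assoc,
      koszulDiff_extDiag h, mul_add]
    abel

theorem exists_periodic_to_koszul {t y : Fin r → S} {x a : Fin r → B}
    (h : ∀ i, algebraMap B S (x i) = y i * t i)
    (hW : HasDividedPowers (coeffForm y) fun i ↦ a i • t i) :
    ∃ g : ℕ → (ℕ →₀ ExteriorAlgebra B (Fin r → B)) →ₗ[B] ExteriorAlgebra S (Fin r → S),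
      (∀ j μ, koszulDiff (coeffForm y) (g (j + 1) μ) = g j (periodicDiff (coeffForm x) a μ)) ∧
      (∃ J, ∀ j, J ≤ j → g j = 0) ∧
      ∀ μ, g 0 μ = algebraMap B _ (ExteriorAlgebra.algebraMapInv (μ 0)) := by
  obtain ⟨W, hW0, hW, N, hN⟩ := hW
  have := (ExteriorAlgebra.free_finite B r).2
  obtain ⟨N', hN'⟩ := exists_forall_extProj_eq_zero (R := B) (V := Fin r → B)
  let g (j : ℕ) : (ℕ →₀ ExteriorAlgebra B (Fin r → B)) →ₗ[B] ExteriorAlgebra S (Fin r → S) :=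
    Finsupp.lsum ℕ fun n ↦ LinearMap.mulRight B (W n) ∘ₗ (extDiag t).toLinearMap ∘ₗ
      extProj B ((j : ℤ) - 2 * n)
  have hg (j n : ℕ) (μ) : g j (.single n μ) = extDiag t (extProj B ((j : ℤ) - 2 * n) μ) * W n := by
    simp [g]
  refine ⟨g, fun j μ ↦ ?_, ⟨2 * N + N'.toNat, fun j hj ↦ ?_⟩, fun μ ↦ ?_⟩
  · induction μ using Finsupp.induction_linear with
    | zero => simp only [map_zero]
    | add μ ν hμ hν => simp only [map_add, hμ, hν]
    | single n μ =>
      cases n with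
      | zero =>
        have e : ((j + 1 : ℕ) : ℤ) - 2 * (0 : ℕ) = j - 2 * (0 : ℕ) + 1 := by push_cast; ring
        rw [periodicDiff_single_zero, hg, hg, hW0, mul_one, mul_one, koszulDiff_extDiag h, e,
          koszulDiff_extProj]
      | succ n =>
        have e : ((j + 1 : ℕ) : ℤ) - 2 * (n + 1 : ℕ) = j - 2 * (n + 1 : ℕ) + 1 := by
          push_cast; ring
        have e' : (j : ℤ) - 2 * n = ((j + 1 : ℕ) : ℤ) - 2 * (n + 1 : ℕ) + 1 := by
          push_cast; ring
        rw [periodicDiff_single_succ, map_add, hg, hg, hg, koszulDiff_extDiag_mul h (hW n),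
          ← extDiag_ι, ← mul_assoc, ← map_mul, ← extProj_ι_mul, ← e', e, koszulDiff_extProj]
  · refine Finsupp.lhom_ext fun n μ ↦ ?_
    rw [hg]
    by_cases hn : N ≤ n
    · rw [hN n hn, mul_zero]; rfl
    · rw [hN' _ (by omega)]; simp
  · induction μ using Finsupp.induction_linear with
    | zero => simp only [map_zero, Finsupp.coe_zero, Pi.zero_apply]
    | add μ ν hμ hν => simp only [map_add, hμ, hν, Finsupp.coe_add, Pi.add_apply]
    | single n μ =>
      cases n with
      | zero => rw [hg, hW0]; simp [extProj_zero_eq]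
      | succ n => rw [hg, extProj, if_neg (by push_cast; omega)]; simp

theorem exists_lift_from_exteriorAlgebra {I₀ I₁ I₂ : Type*} [AddCommGroup I₀] [Module B I₀]
    [AddCommGroup I₁] [Module B I₁] [AddCommGroup I₂] [Module B I₂]
    {d₀ : I₀ →ₗ[B] I₁} {d₁ : I₁ →ₗ[B] I₂}
    (h : ∀ c : S →ₗ[B] I₁, d₁ ∘ₗ c = 0 → ∃ l : S →ₗ[B] I₀, d₀ ∘ₗ l = c)
    (c : ExteriorAlgebra S (Fin r → S) →ₗ[B] I₁) (hc : d₁ ∘ₗ c = 0) :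
    ∃ l : ExteriorAlgebra S (Fin r → S) →ₗ[B] I₀, d₀ ∘ₗ l = c := by
  let b := (Pi.basisFun S (Fin r)).ExteriorAlgebra
  choose l hl using fun s ↦ h (c ∘ₗ (LinearMap.toSpanSingleton S _ (b s)).restrictScalars B)
    (by rw [← LinearMap.comp_assoc, hc, LinearMap.zero_comp])
  refine ⟨∑ s, l s ∘ₗ (b.coord s).restrictScalars B, LinearMap.ext fun x ↦ ?_⟩
  have hl' (s) (k : S) : d₀ (l s k) = c (k • b s) := LinearMap.congr_fun (hl s) k
  simp only [LinearMap.comp_apply, LinearMap.sum_apply, map_sum, hl',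
    LinearMap.restrictScalars_apply, Module.Basis.coord_apply]
  rw [← map_sum, b.sum_repr]

end KoszulFrobenius

section LinearPart

variable {B Q : Type*} [CommRing B] [AddCommGroup Q] [Module B Q] {r : ℕ}

theorem algebraMapInv_ι_mul {R V : Type*} [CommRing R] [AddCommGroup V] [Module R V] (v : V)
    (μ : ExteriorAlgebra R V) : ExteriorAlgebra.algebraMapInv (ExteriorAlgebra.ι R v * μ) = 0 := by
  rw [map_mul]
  simp [ExteriorAlgebra.algebraMapInv]

/-- The map on the exterior algebra sending the `i`-th basis vector to `v i`. -/
noncomputable def linearPart (v : Fin r → Q) : ExteriorAlgebra B (Fin r → B) →ₗ[B] Q :=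
  ∑ i, LinearMap.toSpanSingleton B Q (v i) ∘ₗ ExteriorAlgebra.algebraMapInv.toLinearMap ∘ₗ
    koszulDiff (LinearMap.proj i)

theorem linearPart_ι_mul (v : Fin r → Q) (a : Fin r → B) (μ : ExteriorAlgebra B (Fin r → B)) :
    linearPart v (ExteriorAlgebra.ι B a * μ) =
      ExteriorAlgebra.algebraMapInv μ • ∑ i, a i • v i := by
  simp only [linearPart, LinearMap.sum_apply, LinearMap.comp_apply, koszulDiff_ι_mul, map_sub,
    map_smul, AlgHom.toLinearMap_apply, algebraMapInv_ι_mul, LinearMap.proj_apply,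
    sub_zero, LinearMap.toSpanSingleton_apply, Finset.smul_sum, smul_smul, smul_eq_mul,
    mul_comm]

theorem linearPart_algebraMap (v : Fin r → Q) (b : B) :
    linearPart v (algebraMap B (ExteriorAlgebra B (Fin r → B)) b) = 0 := by
  simp [linearPart]

theorem map_linearPart {L : Type*} [AddCommGroup L] [Module B L] (π : Q →ₗ[B] L) {l : L}
    {v : Fin r → Q} {x : Fin r → B} (h : ∀ i, π (v i) = x i • l)
    (μ : ExteriorAlgebra B (Fin r → B)) :
    π (linearPart v μ) = ExteriorAlgebra.algebraMapInv (koszulDiff (coeffForm x) μ) • l := by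
  induction μ using exteriorAlgebra_induction with
  | algebraMap c => rw [linearPart_algebraMap, koszulDiff_algebraMap]; simp
  | add μ ν hμ hν => simp only [map_add, hμ, hν, add_smul]
  | ι_mul a μ _ =>
    rw [linearPart_ι_mul, koszulDiff_ι_mul, map_sub, algebraMapInv_ι_mul, sub_zero, map_smul,
      map_smul, map_sum, smul_eq_mul, coeffForm_apply, mul_comm, mul_smul, Finset.sum_smul]
    simp only [map_smul, h, smul_smul, mul_comm]

theorem linearPart_koszulDiff {v : Fin r → Q} {x : Fin r → B}
    (h : ∀ i j, x i • v j = x j • v i) (μ : ExteriorAlgebra B (Fin r → B)) :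
    linearPart v (koszulDiff (coeffForm x) μ) = 0 := by
  have key (a c : Fin r → B) : coeffForm x a • ∑ i, c i • v i = coeffForm x c • ∑ i, a i • v i := by
    simp only [coeffForm_apply, Finset.sum_smul, Finset.smul_sum]
    rw [Finset.sum_comm]
    refine Finset.sum_congr rfl fun i _ ↦ Finset.sum_congr rfl fun j _ ↦ ?_
    linear_combination (norm := module) (a i * c j) • h i j
  have key' (a : Fin r → B) (μ : ExteriorAlgebra B (Fin r → B)) :
      coeffForm x a • linearPart v μ =
        ExteriorAlgebra.algebraMapInv (koszulDiff (coeffForm x) μ) • ∑ i, a i • v i := by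
    induction μ using exteriorAlgebra_induction with
    | algebraMap c => rw [linearPart_algebraMap, koszulDiff_algebraMap]; simp
    | add μ ν hμ hν => simp only [map_add, hμ, hν, add_smul, smul_add]
    | ι_mul c μ _ =>
      rw [linearPart_ι_mul, koszulDiff_ι_mul, map_sub, algebraMapInv_ι_mul, sub_zero, map_smul,
        smul_eq_mul, mul_smul, smul_comm, key, smul_comm]
  induction μ using exteriorAlgebra_induction with
  | algebraMap c => rw [koszulDiff_algebraMap, map_zero]
  | add μ ν hμ hν => rw [map_add, map_add, hμ, hν, add_zero]
  | ι_mul a μ _ =>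
    rw [koszulDiff_ι_mul, map_sub, map_smul, linearPart_ι_mul, key', sub_self]

/-- Let `S` be a `B`-algebra of characteristic `p` for which maps into some injective resolution
lift in high degrees, and let `∑ aᵢ xᵢ = 0` be a relation in `B` whose members have compatible
`p`-th roots in `S`.  Then this relation imposes no obstruction in a Yoneda extension. -/
theorem false_of_relation (p : ℕ) [Fact p.Prime] {S L κ : Type*} [CommRing S] [CharP S p]
    [Algebra B S] [AddCommGroup L] [Module B L] [AddCommGroup κ] [Module B κ]
    (x a : Fin r → B) (y b : Fin r → S) (hx : ∀ i, algebraMap B S (x i) = y i ^ p)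
    (ha : ∀ i, algebraMap B S (a i) = b i ^ p) (hax : ∑ i, a i * x i = 0)
    (hby : ∑ i, b i * y i = 0) (q : Ideal B) (haq : ∀ i, a i ∈ q)
    {I : ℕ → Type*} [∀ n, AddCommGroup (I n)] [∀ n, Module B (I n)]
    (d : ∀ n, I n →ₗ[B] I (n + 1)) (hI : ∀ n, Module.Baer B (I n))
    (hd : ∀ n, Function.Exact (d n) (d (n + 1))) (N : ℕ)
    (hS : ∀ n, N ≤ n + 1 → ∀ c : S →ₗ[B] I (n + 1), d (n + 1) ∘ₗ c = 0 →
      ∃ l : S →ₗ[B] I n, d n ∘ₗ l = c)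
    (hq : ∀ b ∈ q, ∀ v, d 0 v = 0 → b • v = 0)
    (π : Q →ₗ[B] L) (ε : L →ₗ[B] κ) (hπε : Function.Exact π ε) (hε : Function.Surjective ε)
    (θ : LinearMap.ker π →ₗ[B] κ) (z : κ →ₗ[B] I 0) (hz : d 0 ∘ₗ z = 0)
    (l : L) (v : Fin r → Q) (hv : ∀ i, π (v i) = x i • l) (hv' : ∀ i j, x i • v j = x j • v i)
    (hθ : ∃ h : ∑ i, a i • v i ∈ LinearMap.ker π, θ ⟨_, h⟩ = ε l) (hzl : z (ε l) ≠ 0)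
    (ρ : S →ₗ[B] κ) (hρ : ρ 1 = ε l) (hρy : ∀ i s, ρ (y i * s) = 0) : False := by
  have hp : p - 1 + 1 = p := Nat.sub_add_cancel (Fact.out : p.Prime).one_le
  have hW : HasDividedPowers (coeffForm y) fun i ↦ a i • y i ^ (p - 1) := by
    have hη (i) : coeffForm y (Pi.single i (b i)) = b i * y i := by
      simp [coeffForm_apply, Pi.single_apply, mul_comm]
    convert hasDividedPowers_of_sum_eq_zero p (coeffForm y) (fun i ↦ Pi.single i (b i)) ?_
      using 1
    · ext i
      simp only [hη, Finset.sum_apply, Pi.smul_apply, Pi.single_apply, smul_eq_mul,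
        mul_ite, mul_zero, Finset.sum_ite_eq, Finset.mem_univ, if_true]
      rw [Algebra.smul_def, ha, mul_pow, mul_right_comm, ← pow_succ, hp]
    · simpa only [hη] using hby
  obtain ⟨g, hg, ⟨J, hJ⟩, hg0⟩ := exists_periodic_to_koszul (t := fun i ↦ y i ^ (p - 1))
    (y := y) (x := x) (fun i ↦ by rw [hx, ← pow_succ', hp]) hW
  have := (ExteriorAlgebra.free_finite B r).1
  have hxa : coeffForm x a = 0 := by
    rw [coeffForm_apply, ← hax]
    exact Finset.sum_congr rfl fun i _ ↦ mul_comm _ _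
  have haug (μ : ExteriorAlgebra S (Fin r → S)) :
      ρ (ExteriorAlgebra.algebraMapInv (koszulDiff (coeffForm y) μ)) = 0 := by
    induction μ using exteriorAlgebra_induction with
    | algebraMap c => rw [koszulDiff_algebraMap, map_zero, map_zero]
    | add μ ν hμ hν => rw [map_add, map_add, map_add, hμ, hν, add_zero]
    | ι_mul c μ _ =>
      rw [koszulDiff_ι_mul, map_sub, algebraMapInv_ι_mul, sub_zero, map_smul, coeffForm_apply,
        smul_eq_mul, Finset.sum_mul, map_sum]
      exact Finset.sum_eq_zero fun i _ ↦ by rw [mul_assoc, hρy]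
  obtain ⟨hker, hθ⟩ := hθ
  have hlin (n : ℕ) (μ : ℕ →₀ ExteriorAlgebra B (Fin r → B)) :
      linearPart v (periodicDiff (coeffForm x) a μ n) =
        ExteriorAlgebra.algebraMapInv (μ (n + 1)) • ∑ i, a i • v i := by
    rw [periodicDiff_apply, map_add, linearPart_koszulDiff hv', zero_add, linearPart_ι_mul]
  refine false_of_bounded_factorization (I₀ := fun m ↦ I (2 * m)) (I₁ := fun m ↦ I (2 * m + 1))
    (fun m ↦ d (2 * m)) (fun m ↦ d (2 * m + 1)) (fun m ↦ hI _) (fun m ↦ hI _)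
    (fun m ↦ hd (2 * m)) (fun m ↦ hd (2 * m + 1)) π ε hπε hε θ z hz q hq
    ((koszulDiff (coeffForm y)).restrictScalars B)
    (LinearMap.ext fun μ ↦ koszulDiff_koszulDiff _ _) N
    (fun m hm c hc ↦ exists_lift_from_exteriorAlgebra (hS (2 * m) (by omega)) c hc)
    (fun m hm c hc ↦ exists_lift_from_exteriorAlgebra (hS (2 * m + 1) (by omega)) c hc)
    (periodicDiff (coeffForm x) a) (LinearMap.ext fun μ ↦ periodicDiff_periodicDiff _ _ hxa μ)
    g (fun j ↦ LinearMap.ext (hg j)) J hJ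
    (ρ ∘ₗ (ExteriorAlgebra.algebraMapInv.toLinearMap).restrictScalars B)
    (LinearMap.ext haug) (fun n ↦ linearPart v ∘ₗ Finsupp.lapply n)
    (fun n ↦ LinearMap.toSpanSingleton B L l ∘ₗ ExteriorAlgebra.algebraMapInv.toLinearMap ∘ₗ
      Finsupp.lapply n) (LinearMap.ext fun μ ↦ ?_) (fun n ↦ LinearMap.ext fun μ ↦ ?_)
    (fun n μ ↦ ?_) fun n ↦ ⟨.single (n + 1) 1, ?_, ?_⟩
  · simp only [LinearMap.comp_apply, hg0, LinearMap.restrictScalars_apply,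
      AlgHom.toLinearMap_apply, Finsupp.lapply_apply, LinearMap.toSpanSingleton_apply, map_smul,
      ← hρ]
    rw [IsScalarTower.algebraMap_apply B S, ExteriorAlgebra.algebraMap_leftInverse,
      Algebra.algebraMap_eq_smul_one, map_smul]
  · simp only [LinearMap.comp_apply, AlgHom.toLinearMap_apply, Finsupp.lapply_apply,
      LinearMap.toSpanSingleton_apply, map_linearPart π hv, periodicDiff_apply, map_add,
      algebraMapInv_ι_mul, add_zero]
  · refine ⟨?_, ?_⟩
    · simp only [LinearMap.comp_apply, Finsupp.lapply_apply, hlin]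
      exact Submodule.smul_mem _ _ hker
    · simp only [LinearMap.comp_apply, Finsupp.lapply_apply, hlin, AlgHom.toLinearMap_apply,
        LinearMap.toSpanSingleton_apply, map_smul, ← hθ]
      exact map_smul θ _ ⟨_, hker⟩
  · rw [periodicDiff_single_succ, koszulDiff_one, Finsupp.single_zero, zero_add, mul_one,
      pi_eq_sum_univ a, map_sum, ← Finsupp.lsingle_apply (R := B), map_sum]
    refine Submodule.sum_mem _ fun i _ ↦ ?_
    rw [map_smul, map_smul]
    exact Submodule.smul_mem_smul (haq i) trivial
  · simpa using hzl

end LinearPart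

section CoefficientField

/-- A ring of characteristic `p` mapping onto a field with square-zero kernel contains a
coefficient field. -/
theorem exists_coefficient_subring (p : ℕ) [Fact p.Prime] {R k : Type*} [CommRing R] [CharP R p]
    [Field k] (π : R →+* k) (hπ : Function.Surjective π)
    (hker : ∀ x y, π x = 0 → π y = 0 → x * y = 0) :
    ∃ K : Subring R, (∀ x ∈ K, π x = 0 → x = 0) ∧ ∀ x, ∃ y ∈ K, π y = π x := by
  have hp : p.Prime := Fact.out
  have hpow (x : R) (hx : π x = 0) : x ^ p = 0 := by
    rw [← Nat.sub_add_cancel hp.two_le, pow_add, pow_two, hker x x hx hx, mul_zero]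
  let T : Set (Subring R) := {K | (frobenius R p).range ≤ K ∧ ∀ x ∈ K, π x = 0 → x = 0}
  have hT : (frobenius R p).range ∈ T := by
    refine ⟨le_rfl, ?_⟩
    rintro _ ⟨x, rfl⟩ h0
    rw [frobenius_def] at h0 ⊢
    exact hpow x (pow_eq_zero_iff hp.ne_zero |>.1 (by rwa [map_pow] at h0))
  obtain ⟨K, -, hK⟩ := zorn_le_nonempty₀ T (fun c hcT hc K hKc ↦
    ⟨sSup c, ⟨(hcT hKc).1.trans (le_sSup hKc), fun x hx h0 ↦ by
      obtain ⟨K', hK', hx⟩ := (Subring.mem_sSup_of_directedOn ⟨K, hKc⟩ hc.directedOn).1 hx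
      exact (hcT hK').2 x hx h0⟩, fun _ h ↦ le_sSup h⟩) _ hT
  obtain ⟨⟨hK₁, hK₂⟩, hKmax⟩ := hK
  have hKp (x : R) : x ^ p ∈ K := hK₁ ⟨x, rfl⟩
  have hfield : IsField K := by
    have : Nontrivial R := π.domain_nontrivial
    refine ⟨⟨0, 1, zero_ne_one⟩, mul_comm, fun {x} hx ↦ ?_⟩
    have hx' : π x ≠ 0 := fun h ↦ hx (Subtype.ext (hK₂ x x.2 h))
    obtain ⟨w, hw⟩ := hπ (π x)⁻¹
    refine ⟨⟨w ^ p, hKp w⟩ * x ^ (p - 1), Subtype.ext ?_⟩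
    have h1 : (w * x - 1) ^ p = 0 := hpow _ (by simp [hw, hx'])
    rw [sub_pow_char, one_pow, sub_eq_zero, mul_pow] at h1
    simp only [Subring.coe_mul, SubmonoidClass.coe_pow, Subring.coe_one]
    rw [← h1, mul_left_comm, ← pow_succ', Nat.sub_add_cancel hp.one_le]
  refine ⟨K, hK₂, fun a ↦ ?_⟩
  by_contra! ha
  let _ : Field K := hfield.toField
  let c : K := ⟨a ^ p, hKp a⟩
  have hirr : Irreducible (Polynomial.X ^ p - Polynomial.C c) := by
    refine X_pow_sub_C_irreducible_of_prime hp fun b hb ↦ ha b b.2 ?_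
    have h1 : (b : R) ^ p = a ^ p := congrArg Subtype.val hb
    rw [← sub_eq_zero, ← map_sub]
    refine pow_eq_zero_iff hp.ne_zero |>.1 ?_
    rw [← map_pow, sub_pow_char, h1, sub_self, map_zero]
  let φ : Polynomial K →+* R := Polynomial.eval₂RingHom K.subtype a
  have hφ : φ (Polynomial.X ^ p - Polynomial.C c) = 0 := by simp [φ, c]
  have hle : K ≤ φ.range := fun x hx ↦ ⟨Polynomial.C ⟨x, hx⟩, by simp [φ]⟩
  refine ha a (hKmax ⟨hK₁.trans hle, ?_⟩ hle ⟨Polynomial.X, by simp [φ]⟩) rfl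
  rintro _ ⟨f, rfl⟩ hf
  obtain ⟨h, rfl⟩ : Polynomial.X ^ p - Polynomial.C c ∣ f := by
    by_contra hdvd
    obtain ⟨u, v, huv⟩ := (hirr.coprime_iff_not_dvd).2 hdvd
    have := congrArg (π.comp φ) huv
    simp [hφ, hf] at this
  rw [map_mul, hφ, zero_mul]

end CoefficientField

section Splitting

theorem Ideal.exists_isCompl_of_inf_sq_eq_bot {E : Type*} [CommRing E] (m N : Ideal E)
    [hm : m.IsMaximal] (hN : N ≤ m) (h : N ⊓ m ^ 2 = ⊥) :
    ∃ N' : Ideal E, m ^ 2 ≤ N' ∧ N' ≤ m ∧ N' ⊓ N = ⊥ ∧ N' ⊔ N = m := by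
  let T : Set (Ideal E) := {I | m ^ 2 ≤ I ∧ I ≤ m ∧ I ⊓ N = ⊥}
  have hT : m ^ 2 ∈ T := ⟨le_rfl, Ideal.pow_le_self two_ne_zero, by rw [inf_comm, h]⟩
  obtain ⟨I, -, hI⟩ := zorn_le_nonempty₀ T (fun c hcT hc J hJ ↦
    ⟨sSup c, ⟨(hcT hJ).1.trans (le_sSup hJ), sSup_le fun _ h ↦ (hcT h).2.1, by
      refine eq_bot_iff.2 fun x ⟨hx, hxN⟩ ↦ ?_
      obtain ⟨J', hJ', hx⟩ := (Submodule.mem_sSup_of_directed ⟨J, hJ⟩ hc.directedOn).1 hx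
      exact (hcT hJ').2.2.le ⟨hx, hxN⟩⟩, fun _ h ↦ le_sSup h⟩) _ hT
  obtain ⟨⟨h₁, h₂, h₃⟩, hmax⟩ := hI
  refine ⟨I, h₁, h₂, h₃, le_antisymm (sup_le h₂ hN) fun x hx ↦ ?_⟩
  by_contra hxI
  have hle : I ⊔ Ideal.span {x} ≤ I := by
    refine hmax ⟨h₁.trans le_sup_left, sup_le h₂ ((Ideal.span_singleton_le_iff_mem _).2 hx),
      eq_bot_iff.2 fun n ⟨hn, hnN⟩ ↦ ?_⟩ le_sup_left
    obtain ⟨n', hn', y, hy, rfl⟩ := Submodule.mem_sup.1 hn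
    obtain ⟨e, rfl⟩ := Ideal.mem_span_singleton'.1 hy
    by_cases he : e ∈ m
    · exact h₃.le ⟨I.add_mem hn' (h₁ (pow_two m ▸ Ideal.mul_mem_mul he hx)), hnN⟩
    · obtain ⟨w, i, hi, hw⟩ := hm.exists_inv he
      refine (hxI ?_).elim
      have hxe : x = (i * x - w * n') + w * (n' + e * x) := by linear_combination -x * hw
      rw [hxe]
      exact Submodule.add_mem_sup
        (I.sub_mem (h₁ (pow_two m ▸ Ideal.mul_mem_mul hi hx)) (I.mul_mem_left _ hn'))
        (N.mul_mem_left _ hnN)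
  exact hxI (Ideal.mem_sup_left (hle (Ideal.mem_sup_right (Ideal.mem_span_singleton_self x))))

/-- A surjection of rings of characteristic `p` onto a local ring splits as soon as its kernel
meets the square of the maximal ideal trivially. -/
theorem exists_ringHom_section_of_ker_inf_sq_eq_bot (p : ℕ) [Fact p.Prime] {E L : Type*}
    [CommRing E] [CommRing L] [IsLocalRing L] (hp : (p : E) = 0) (π : E →+* L)
    (hπ : Function.Surjective π)
    (h : RingHom.ker π ⊓ (Ideal.comap π (IsLocalRing.maximalIdeal L)) ^ 2 = ⊥) :
    ∃ σ : L →+* E, π.comp σ = RingHom.id L := by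
  set m := Ideal.comap π (IsLocalRing.maximalIdeal L)
  have hm : m.IsMaximal := Ideal.comap_isMaximal_of_surjective π hπ
  have hNm : RingHom.ker π ≤ m := Ideal.comap_mono bot_le
  obtain ⟨N', h₁, h₂, h₃, h₄⟩ := m.exists_isCompl_of_inf_sq_eq_bot (RingHom.ker π) hNm h
  let ϖ : E ⧸ N' →+* E ⧸ m := Ideal.Quotient.factor h₂
  have : Nontrivial (E ⧸ N') := ϖ.domain_nontrivial
  have : CharP (E ⧸ N') p := by
    rw [CharP.charP_iff_prime_eq_zero Fact.out, ← map_natCast (Ideal.Quotient.mk N'), hp, map_zero]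
  let _ := Ideal.Quotient.field m
  obtain ⟨K, hK₁, hK₂⟩ := exists_coefficient_subring p ϖ (Ideal.Quotient.factor_surjective h₂) (by
    intro x y hx hy
    obtain ⟨x, rfl⟩ := Ideal.Quotient.mk_surjective x
    obtain ⟨y, rfl⟩ := Ideal.Quotient.mk_surjective y
    rw [Ideal.Quotient.factor_mk, Ideal.Quotient.eq_zero_iff_mem] at hx hy
    rw [← map_mul, Ideal.Quotient.eq_zero_iff_mem]
    exact h₁ (pow_two m ▸ Ideal.mul_mem_mul hx hy))
  let G : Subring E := K.comap (Ideal.Quotient.mk N')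
  have hNG {x : E} (hx : x ∈ N') : x ∈ G := by
    simp [G, Ideal.Quotient.eq_zero_iff_mem.2 hx, K.zero_mem]
  let e : G ≃+* L := RingEquiv.ofBijective (π.comp G.subtype) ⟨by
    refine (injective_iff_map_eq_zero _).2 fun ⟨x, hxK⟩ hx ↦ Subtype.ext ?_
    have hx' : x ∈ RingHom.ker π := hx
    have hxN := hK₁ _ hxK (by
      rw [Ideal.Quotient.factor_mk, Ideal.Quotient.eq_zero_iff_mem]
      exact hNm hx')
    exact h₃.le ⟨Ideal.Quotient.eq_zero_iff_mem.1 hxN, hx'⟩, fun y ↦ by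
    obtain ⟨x, rfl⟩ := hπ y
    obtain ⟨k, hk, hkx⟩ := hK₂ (Ideal.Quotient.mk N' x)
    obtain ⟨g, rfl⟩ := Ideal.Quotient.mk_surjective k
    rw [Ideal.Quotient.factor_mk, Ideal.Quotient.factor_mk, Ideal.Quotient.eq, ← h₄] at hkx
    obtain ⟨n', hn', n, hn, hgx⟩ := Submodule.mem_sup.1 hkx
    refine ⟨⟨g - n', G.sub_mem hk (hNG hn')⟩, ?_⟩
    have : g - n' = x + n := by linear_combination -hgx
    simp [this, RingHom.mem_ker.1 hn]⟩
  refine ⟨G.subtype.comp e.symm, RingHom.ext fun y ↦ ?_⟩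
  exact e.apply_symm_apply y

end Splitting

section Relation

/-- A module over the source of a surjective ring homomorphism `π` which is killed by the kernel
of `π` is a module over every ring mapping to the target of `π`. -/
theorem exists_module_of_ker_smul_eq_zero {B E L Q : Type*} [CommRing B] [CommRing E] [CommRing L]
    [AddCommGroup Q] [Module E Q] (f : B →+* L) (π : E →+* L) (hπ : Function.Surjective π)
    (h : ∀ e, π e = 0 → ∀ x : Q, e • x = 0) :
    ∃ _ : Module B Q, ∀ (b : B) (e : E) (x : Q), π e = f b → b • x = e • x := by
  choose g hg using fun b ↦ hπ (f b)
  have key (b : B) (e : E) (x : Q) (he : π e = f b) : g b • x = e • x := by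
    rw [← sub_eq_zero, ← sub_smul]
    exact h _ (by rw [map_sub, hg, he, sub_self]) x
  refine ⟨{ smul := fun b x ↦ g b • x
            one_smul := fun x ↦ ?_
            mul_smul := fun b c x ↦ ?_
            smul_zero := fun b ↦ smul_zero (g b)
            smul_add := fun b ↦ smul_add (g b)
            add_smul := fun b c x ↦ ?_
            zero_smul := fun x ↦ ?_ }, key⟩
  · exact (key (b * c) (g b * g c) x (by simp [hg])).trans (mul_smul _ _ _)
  · exact (key 1 1 x (by simp)).trans (one_smul _ _)
  · exact (key (b + c) (g b + g c) x (by simp [hg])).trans (add_smul _ _ _)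
  · exact (key 0 0 x (by simp)).trans (zero_smul _ _)

theorem exists_linearMap_frob_apply_one (p : ℕ) [Fact p.Prime] {B : Type u} {κ : Type v}
    [CommRing B] [CharP B p] [Field κ] [Algebra B κ] :
    ∃ ρ : Frob p B →ₗ[B] κ, ρ 1 = 1 ∧
      ∀ b : B, algebraMap B κ b = 0 → ∀ s : Frob p B, ρ ((id b : Frob p B) * s) = 0 := by
  have : CharP κ p := by
    rw [CharP.charP_iff_prime_eq_zero Fact.out, ← map_natCast (algebraMap B κ),
      CharP.cast_eq_zero, map_zero]
  have : Nontrivial (Frob p κ) := inferInstanceAs (Nontrivial κ)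
  obtain ⟨φ, hφ⟩ := Module.Projective.exists_dual_eq_one κ (one_ne_zero (α := Frob p κ))
  let F : Frob p B →+* Frob p κ := algebraMap B κ
  refine ⟨{ toFun := fun s ↦ φ (F s)
            map_add' := fun s t ↦ by rw [map_add, map_add]
            map_smul' := fun b s ↦ ?_ }, ?_, fun b hb s ↦ ?_⟩
  · have h : F (b • s) = algebraMap B κ b • F s := by
      rw [Algebra.smul_def, Algebra.smul_def, map_mul]
      congr 1
      exact map_pow (algebraMap B κ) b p
    rw [h, map_smul, RingHom.id_apply, smul_eq_mul, ← Algebra.smul_def]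
  · change φ (F 1) = 1
    rw [map_one, hφ]
  · change φ (F (_ * s)) = 0
    rw [map_mul, show F (id b) = 0 from hb, zero_mul, map_zero]

theorem Ideal.exists_sum_mul_eq_of_mem_sq {E : Type*} [CommRing E] {m : Ideal E} {f : E}
    (hf : f ∈ m ^ 2) : ∃ (r : ℕ) (u v : Fin r → m), ∑ i, (u i : E) * v i = f := by
  have hf' : f ∈ m • Submodule.span E (Set.range ((↑) : m → E)) := by
    rwa [Subtype.range_coe, Submodule.span_eq, smul_eq_mul, ← pow_two]
  obtain ⟨a, ha, rfl⟩ := (Submodule.mem_ideal_smul_span_iff_exists_sum m _ f).1 hf'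
  let e := a.support.equivFin.symm
  refine ⟨_, fun i ↦ ⟨a (e i), ha _⟩, fun i ↦ e i, ?_⟩
  rw [e.sum_comp (fun i ↦ a i * ((i : m) : E)), Finset.sum_coe_sort a.support
    (fun i ↦ a i * (i : E))]
  rfl

variable {B L E : Type*} [CommRing B] [CommRing L] [IsLocalRing L] [Algebra B L] [CommRing E]

/-- A nonzero element in the kernel and in the square of the maximal ideal yields, after clearing
denominators, a relation `∑ i, a i * x i = 0` in `B` which does not lift to `E`. -/
theorem exists_relation_of_mem_ker_inf_sq (q : Ideal B) [q.IsPrime] [IsLocalization.AtPrime L q]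
    (π : E →+* L) (hπ : Function.Surjective π)
    (hm : ∀ x n, π x ∈ IsLocalRing.maximalIdeal L → π n = 0 → x * n = 0) {f : E} (hf₀ : f ≠ 0)
    (hf : π f = 0) (hf₂ : f ∈ (Ideal.comap π (IsLocalRing.maximalIdeal L)) ^ 2) :
    ∃ (r : ℕ) (a x : Fin r → B) (α v : Fin r → E), (∀ i, a i ∈ q) ∧ (∀ i, x i ∈ q) ∧
      ∑ i, a i * x i = 0 ∧ (∀ i, π (α i) = algebraMap B L (a i)) ∧
      (∀ i, π (v i) = algebraMap B L (x i)) ∧ ∑ i, α i * v i ≠ 0 := by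
  obtain ⟨r, u, v, rfl⟩ := Ideal.exists_sum_mul_eq_of_mem_sq hf₂
  have hden (w : Fin r → Ideal.comap π (IsLocalRing.maximalIdeal L)) :
      ∃ (s : q.primeCompl) (b : Fin r → B), (∀ i, b i ∈ q) ∧
        ∀ i, algebraMap B L (b i) = algebraMap B L s * π (w i) := by
    obtain ⟨s, hs⟩ := IsLocalization.exist_integer_multiples_of_finite q.primeCompl
      fun i ↦ π (w i)
    choose b hb using hs
    simp only [Algebra.smul_def] at hb
    refine ⟨s, b, fun i ↦ ?_, hb⟩
    rw [← IsLocalization.AtPrime.to_map_mem_maximal_iff L q, hb]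
    exact Ideal.mul_mem_left _ _ (w i).2
  obtain ⟨s, a, ha, hsa⟩ := hden u
  obtain ⟨t, x, hx, htx⟩ := hden v
  have hax : algebraMap B L (∑ i, a i * x i) = 0 := by
    rw [map_sum]
    simp only [map_mul, hsa, htx]
    simp only [mul_mul_mul_comm, ← Finset.mul_sum, ← map_mul, ← map_sum, hf, mul_zero]
  obtain ⟨w, hw⟩ := (IsLocalization.map_eq_zero_iff q.primeCompl L _).1 hax
  obtain ⟨s', hs'⟩ := hπ (algebraMap B L s)
  obtain ⟨t', ht'⟩ := hπ (algebraMap B L t)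
  obtain ⟨w', hw'⟩ := hπ (algebraMap B L w)
  refine ⟨r, fun i ↦ w * a i, x, fun i ↦ w' * s' * u i, fun i ↦ t' * v i,
    fun i ↦ q.mul_mem_left _ (ha i), hx, ?_, fun i ↦ ?_, fun i ↦ ?_, ?_⟩
  · simpa only [Finset.mul_sum, mul_assoc] using hw
  · rw [map_mul, map_mul, map_mul, hsa, hs', hw', mul_assoc]
  · rw [map_mul, htx, ht']
  · have hunit : IsUnit (π (w' * s' * t')) := by
      rw [map_mul, map_mul, hw', hs', ht', ← map_mul, ← map_mul]
      exact IsLocalization.map_units L (w * s * t)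
    obtain ⟨c, hc⟩ := hunit.exists_right_inv
    obtain ⟨c, rfl⟩ := hπ c
    intro h
    simp only [mul_mul_mul_comm _ _ t', ← Finset.mul_sum] at h
    refine hf₀ ?_
    have h1 := hm (1 - w' * s' * t' * c) _ (by rw [map_sub, map_mul, hc]; simp) hf
    linear_combination h1 + c * h

end Relation

section Conclusion

/-- If the Frobenius of `B` has finite flat dimension, then an extension of a localization of `B`
whose kernel is killed by the maximal ideal has no kernel element in the square of the maximal
ideal. -/
theorem ker_inf_sq_eq_bot_of_isZero_tor (p : ℕ) [Fact p.Prime] {B L : Type u} {E : Type v}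
    [CommRing B] [CharP B p] [CommRing L] [IsLocalRing L] [Algebra B L] [CommRing E] (N : ℕ)
    (hfd : ∀ n : ℕ, N ≤ n → ∀ (M : Type u) [AddCommGroup M] [Module B M],
      IsZero (((Tor (ModuleCat.{u} B) n).obj
        (ModuleCat.of B (Frob p B))).obj (ModuleCat.of B M)))
    (q : Ideal B) [q.IsPrime] [IsLocalization.AtPrime L q]
    (π : E →+* L) (hπ : Function.Surjective π)
    (hm : ∀ x n, π x ∈ IsLocalRing.maximalIdeal L → π n = 0 → x * n = 0) :
    RingHom.ker π ⊓ (Ideal.comap π (IsLocalRing.maximalIdeal L)) ^ 2 = ⊥ := by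
  rw [eq_bot_iff]
  rintro f ⟨hf, hf₂⟩
  by_contra hf₀
  obtain ⟨r, a, x, α, v, ha, hx, hax, hα, hv, hne⟩ :=
    exists_relation_of_mem_ker_inf_sq q π hπ hm hf₀ hf hf₂
  let κ := IsLocalRing.ResidueField L
  have hker (b : B) (hb : b ∈ q) : algebraMap B κ b = 0 := by
    rw [IsScalarTower.algebraMap_apply B L κ]
    exact (IsLocalRing.residue_eq_zero_iff _).2
      ((IsLocalization.AtPrime.to_map_mem_maximal_iff L q _).2 hb)
  have hmax (b : B) (hb : b ∈ q) : algebraMap B L b ∈ IsLocalRing.maximalIdeal L :=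
    (IsLocalization.AtPrime.to_map_mem_maximal_iff L q _).2 hb
  obtain ⟨_, hQ⟩ := exists_module_of_ker_smul_eq_zero
    (Q := Ideal.comap π (IsLocalRing.maximalIdeal L)) (algebraMap B L) π hπ
    fun e he y ↦ Subtype.ext (by simpa [mul_comm] using hm y e y.2 he)
  obtain ⟨_, hN⟩ := exists_module_of_ker_smul_eq_zero (Q := RingHom.ker π) (RingHom.id κ)
    ((IsLocalRing.residue L).comp π) (IsLocalRing.residue_surjective.comp hπ)
    fun e he y ↦ Subtype.ext (hm e y ((IsLocalRing.residue_eq_zero_iff _).1 he) y.2)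
  let π' : Ideal.comap π (IsLocalRing.maximalIdeal L) →ₗ[B] L :=
    { toFun := fun y ↦ π y
      map_add' := fun y z ↦ map_add π _ _
      map_smul' := fun b y ↦ by
        obtain ⟨e, he⟩ := hπ (algebraMap B L b)
        rw [hQ b e y he, RingHom.id_apply, Algebra.smul_def, ← he]
        exact map_mul π e y }
  let ε : L →ₗ[B] κ := (IsScalarTower.toAlgHom B L κ).toLinearMap
  have hπε : Function.Exact π' ε := fun y ↦ by
    refine (IsLocalRing.residue_eq_zero_iff y).trans ⟨fun hy ↦ ?_, ?_⟩
    · obtain ⟨e, rfl⟩ := hπ y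
      exact ⟨⟨e, hy⟩, rfl⟩
    · rintro ⟨e, rfl⟩
      exact e.2
  have hε1 : ε 1 = 1 := map_one (IsScalarTower.toAlgHom B L κ)
  have hαv : π (∑ i, α i * v i) = 0 := by
    simp only [map_sum, map_mul, hα, hv]
    simp only [← map_mul, ← map_sum, hax, map_zero]
  obtain ⟨φ, hφ⟩ := Module.Projective.exists_dual_eq_one κ
    (x := (⟨∑ i, α i * v i, hαv⟩ : RingHom.ker π)) fun h ↦ hne (congrArg Subtype.val h)
  let θ : LinearMap.ker π' →ₗ[B] κ :=
    { toFun := fun y ↦ φ ⟨y.1, y.2⟩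
      map_add' := fun y z ↦ by
        rw [← map_add]
        rfl
      map_smul' := fun b y ↦ by
        obtain ⟨e, he⟩ := hπ (algebraMap B L b)
        have h : (⟨(b • y).1, (b • y).2⟩ : RingHom.ker π) =
            algebraMap B κ b • (⟨y.1, y.2⟩ : RingHom.ker π) := by
          rw [hN _ e _ (by rw [RingHom.comp_apply, he]; rfl)]
          have h1 := Subtype.ext_iff.1 (hQ b e y.1 he)
          exact Subtype.ext h1
        rw [h, map_smul, RingHom.id_apply, algebraMap_smul] }
  obtain ⟨I, _, _, d, ι, hI, hd, hι, hιd, hS⟩ :=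
    exists_injective_resolution_of_isZero_tor (Frob p B) κ N fun n hn ↦ hfd n hn κ
  obtain ⟨χ, hχ⟩ := CharacterModule.exists_character_apply_ne_zero_of_ne_zero
    (one_ne_zero (α := κ))
  let z : κ →ₗ[B] CharacterModule κ :=
    { toFun := fun k ↦ k • χ
      map_add' := fun k l ↦ add_smul k l χ
      map_smul' := fun b k ↦ by
        ext y
        simp only [CharacterModule.smul_apply, RingHom.id_apply, smul_eq_mul, smul_mul_assoc,
          mul_smul_comm] }
  obtain ⟨ρ, hρ1, hρ⟩ := exists_linearMap_frob_apply_one p (B := B) (κ := κ)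
  have : CharP (Frob p B) p := inferInstanceAs (CharP B p)
  let v' (i : Fin r) : Ideal.comap π (IsLocalRing.maximalIdeal L) :=
    ⟨v i, by rw [Ideal.mem_comap, hv]; exact hmax _ (hx i)⟩
  have hsum : ∑ i, a i • v' i = ⟨∑ i, α i * v i, by
      rw [Ideal.mem_comap, hαv]; exact Ideal.zero_mem _⟩ := by
    refine Subtype.ext ?_
    rw [AddSubmonoidClass.coe_finsetSum]
    refine Finset.sum_congr rfl fun i _ ↦ ?_
    rw [hQ _ _ _ (hα i)]
    rfl
  refine false_of_relation p (S := Frob p B) x a (fun i ↦ (id (x i) : Frob p B))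
    (fun i ↦ (id (a i) : Frob p B)) (fun i ↦ rfl) (fun i ↦ rfl) hax hax q ha d hI hd N hS ?_ π' ε
    hπε IsLocalRing.residue_surjective θ (ι ∘ₗ z) ?_ 1 v' (fun i ↦ ?_) (fun i j ↦ ?_)
    ⟨?_, ?_⟩ ?_ ρ (hρ1.trans hε1.symm) fun i s ↦ hρ _ (hker _ (hx i)) s
  · intro b hb w hw
    obtain ⟨c, rfl⟩ := (hιd w).1 hw
    rw [← map_smul, show b • c = 0 from ?_, map_zero]
    ext y
    rw [CharacterModule.smul_apply, Algebra.smul_def, hker b hb, zero_mul, map_zero]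
    rfl
  · rw [← LinearMap.comp_assoc, hιd.linearMap_comp_eq_zero, LinearMap.zero_comp]
  · exact (hv i).trans (by rw [Algebra.smul_def, mul_one])
  · rw [hQ _ (v i) _ (hv i), hQ _ (v j) _ (hv j)]
    exact Subtype.ext (mul_comm _ _)
  · rw [hsum]
    exact hαv
  · rw [hε1, ← hφ]
    have h1 := Subtype.ext_iff.1 hsum
    exact congrArg φ (Subtype.ext h1)
  · rw [hε1]
    intro h
    refine hχ ?_
    have h1 : z 1 = 0 := hι (h.trans (map_zero ι).symm)
    have h2 := DFunLike.congr_fun h1 1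
    change ((1 : κ) • χ) 1 = 0 at h2
    rwa [one_smul] at h2

end Conclusion

/-- **Kunz's theorem, non-noetherian absolute version.** Let `p` be a prime and `B` a
commutative ring of characteristic `p`.  If `^φB` (the ring `B` viewed as a `B`-module via
the Frobenius `b ↦ b ^ p`) has finite flat dimension over `B`, i.e. there is `d` with
`Tor_n^B(^φB, M) = 0` for all `B`-modules `M` and all `n ≥ d`, then the structure
homomorphism `𝔽_p → B` is discretely regular; in particular every localization `B_q` at a
prime is formally smooth over `𝔽_p` for the ideal `q B_q` with the discrete topology. -/
theorem finite_flat_dimension_frobenius_discretelyRegular_over_zmod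
    (p : ℕ) [Fact p.Prime] (B : Type u) [CommRing B] [CharP B p]
    (hfd : ∃ d : ℕ, ∀ n : ℕ, d ≤ n →
        ∀ (M : Type u) [AddCommGroup M] [Module B M],
          IsZero (((Tor (ModuleCat.{u} B) n).obj
            (ModuleCat.of B (Frob p B))).obj (ModuleCat.of B M))) :
    letI : Algebra (ZMod p) B := ZMod.algebra B p
    DiscretelyRegular (ZMod p) B := by
  let _ : Algebra (ZMod p) B := ZMod.algebra B p
  obtain ⟨N, hfd⟩ := hfd
  refine ⟨inferInstance, fun q _ ↦ ?_⟩
  let _ : Algebra (ZMod p) (Localization.AtPrime q) :=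
    ((algebraMap B (Localization.AtPrime q)).comp (algebraMap (ZMod p) B)).toAlgebra
  intro C _ _ M hM u hu
  let L := Localization.AtPrime q
  let E : Subring (C × L) := RingHom.eqLocus
    ((Ideal.Quotient.mk M).comp (RingHom.fst C L)) ((u : L →+* C ⧸ M).comp (RingHom.snd C L))
  let π : E →+* L := (RingHom.snd C L).comp E.subtype
  have hE (y : E) : Ideal.Quotient.mk M y.1.1 = u y.1.2 := y.2
  have hπ : Function.Surjective π := fun y ↦ by
    obtain ⟨c, hc⟩ := Ideal.Quotient.mk_surjective (u y)
    exact ⟨⟨(c, y), hc⟩, rfl⟩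
  have hm (x n : E) (hx : π x ∈ IsLocalRing.maximalIdeal L) (hn : π n = 0) : x * n = 0 := by
    refine Subtype.ext (Prod.ext ?_ ?_)
    · have hnM : n.1.1 ∈ M := by
        rw [← Ideal.Quotient.eq_zero_iff_mem, hE, show n.1.2 = 0 from hn, map_zero]
      have hxM : x.1.1 ∈ Ideal.comap (Ideal.Quotient.mk M)
          (Ideal.map u (Ideal.map (algebraMap B L) q)) := by
        rw [Ideal.mem_comap, hE, Localization.AtPrime.map_eq_maximalIdeal]
        exact Ideal.mem_map_of_mem u hx
      exact hu.le (Ideal.mul_mem_mul hxM hnM)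
    · change π x * π n = 0
      rw [hn, mul_zero]
  have hpE : (p : E) = 0 := by
    refine Subtype.ext (Prod.ext ?_ ?_)
    · change ((p : C × L)).1 = 0
      rw [Prod.fst_natCast, ← map_natCast (algebraMap (ZMod p) C), CharP.cast_eq_zero, map_zero]
    · change ((p : C × L)).2 = 0
      rw [Prod.snd_natCast, ← map_natCast (algebraMap B L), CharP.cast_eq_zero, map_zero]
  obtain ⟨σ, hσ⟩ := exists_ringHom_section_of_ker_inf_sq_eq_bot p hpE π hπ
    (ker_inf_sq_eq_bot_of_isZero_tor p N hfd q π hπ hm)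
  let g : L →+* C := ((RingHom.fst C L).comp E.subtype).comp σ
  refine ⟨{ g with commutes' := fun c ↦
    RingHom.congr_fun (Subsingleton.elim (g.comp (algebraMap (ZMod p) L)) (algebraMap (ZMod p) C)) c },
    AlgHom.ext fun y ↦ ?_⟩
  exact (hE (σ y)).trans (congrArg u (RingHom.congr_fun hσ y))
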